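/- arXiv:2004.05120 — 8 statements merged into one kernel-verified Lean document; each statement's English description precedes it below -/
import Mathlib

section
/- For all real numbers a₀, a₁, c, one has θ(−a₀, −a₁, c) = −θ(a₀, a₁, c). -/
noncomputable def phi (a₀ a₁ c : ℝ) : ℝ := min (max a₀ (-c)) (max a₁ c)

noncomputable def psi (a₀ a₁ c : ℝ) : ℝ := max (min a₀ c) (min a₁ (-c))

noncomputable def theta (a₀ a₁ c : ℝ) : ℝ :=
  max (phi a₀ a₁ c) 0 + min (psi a₀ a₁ c) 0

theorem phi_neg_neg (a₀ a₁ c : ℝ) : phi (-a₀) (-a₁) c = -psi a₀ a₁ c := by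
  simp only [phi, psi, ← min_neg_neg, ← max_neg_neg, neg_neg]

theorem psi_neg_neg (a₀ a₁ c : ℝ) : psi (-a₀) (-a₁) c = -phi a₀ a₁ c := by
  rw [← neg_eq_iff_eq_neg, ← phi_neg_neg, neg_neg, neg_neg]

theorem theta_odd (a₀ a₁ c : ℝ) :
    theta (-a₀) (-a₁) c = -theta a₀ a₁ c := by
  have h_max (x : ℝ) : max (-x) 0 = -min x 0 := by
    simpa using max_neg_neg x 0
  have h_min (x : ℝ) : min (-x) 0 = -max x 0 := by
    simpa using min_neg_neg x 0
  rw [theta, theta, phi_neg_neg, psi_neg_neg, h_max, h_min]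
  ring
end

section
/- For all real numbers a₀, a₁, c, the value θ(a₀, a₁, c) belongs to the set {a₀, a₁, c, −c}. -/
theorem phi_mem (a₀ a₁ c : ℝ) : phi a₀ a₁ c ∈ ({a₀, a₁, c, -c} : Set ℝ) := by
  simp only [Set.mem_insert_iff, Set.mem_singleton_iff, phi]
  grind

theorem psi_mem (a₀ a₁ c : ℝ) : psi a₀ a₁ c ∈ ({a₀, a₁, c, -c} : Set ℝ) := by
  simp only [Set.mem_insert_iff, Set.mem_singleton_iff, psi]
  grind

theorem psi_nonneg_of_phi_pos {a₀ a₁ c : ℝ} (h : 0 < phi a₀ a₁ c) : 0 ≤ psi a₀ a₁ c := by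
  simp only [phi, psi, lt_min_iff, lt_max_iff, le_max_iff, le_min_iff] at h ⊢
  grind

theorem zero_mem_of_phi_nonpos_of_psi_nonneg {a₀ a₁ c : ℝ} (h : phi a₀ a₁ c ≤ 0)
    (h' : 0 ≤ psi a₀ a₁ c) : (0 : ℝ) ∈ ({a₀, a₁, c, -c} : Set ℝ) := by
  simp only [phi, psi, min_le_iff, max_le_iff, le_max_iff, le_min_iff,
    Set.mem_insert_iff, Set.mem_singleton_iff] at h h' ⊢
  grind

theorem theta_mem (a₀ a₁ c : ℝ) :
    theta a₀ a₁ c ∈ ({a₀, a₁, c, -c} : Set ℝ) := by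
  rcases lt_or_ge 0 (phi a₀ a₁ c) with h | h
  · rw [theta, max_eq_left h.le, min_eq_right (psi_nonneg_of_phi_pos h), add_zero]
    exact phi_mem a₀ a₁ c
  rw [theta, max_eq_right h, zero_add]
  rcases le_total 0 (psi a₀ a₁ c) with h' | h'
  · rw [min_eq_right h']
    exact zero_mem_of_phi_nonpos_of_psi_nonneg h h'
  · rw [min_eq_left h']
    exact psi_mem a₀ a₁ c
end

section
/- For all real numbers a₀, a₁, c, if θ(a₀, a₁, c) = 0 then a₀ = 0 or a₁ = 0 or c = 0. -/
theorem theta_swap (a₀ a₁ c : ℝ) : theta a₁ a₀ (-c) = theta a₀ a₁ c := by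
  simp only [theta, phi, psi, neg_neg, min_comm (max a₁ c), max_comm (min a₁ (-c))]

theorem theta_pos {a₀ c : ℝ} (a₁ : ℝ) (ha : 0 < a₀) (hc : 0 < c) : 0 < theta a₀ a₁ c := by
  have hphi : 0 < phi a₀ a₁ c := lt_min (lt_max_of_lt_left ha) (lt_max_of_lt_right hc)
  have hpsi : 0 < psi a₀ a₁ c := lt_max_of_lt_left (lt_min ha hc)
  simpa [theta, hpsi.le] using hphi

theorem theta_neg {a₀ c : ℝ} (a₁ : ℝ) (ha : a₀ < 0) (hc : 0 < c) : theta a₀ a₁ c < 0 := by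
  have hc' : -c < 0 := neg_neg_of_pos hc
  have hphi : phi a₀ a₁ c < 0 := min_lt_of_left_lt (max_lt ha hc')
  have hpsi : psi a₀ a₁ c < 0 := max_lt (min_lt_of_left_lt ha) (min_lt_of_right_lt hc')
  simpa [theta, hphi.le] using hpsi

theorem eq_zero_of_theta_eq_zero_of_pos {a₀ a₁ c : ℝ} (hc : 0 < c) (h : theta a₀ a₁ c = 0) :
    a₀ = 0 := by
  rcases lt_trichotomy a₀ 0 with ha | ha | ha
  · exact absurd h (theta_neg a₁ ha hc).ne
  · exact ha
  · exact absurd h (theta_pos a₁ ha hc).ne'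

theorem theta_eq_zero (a₀ a₁ c : ℝ) (h : theta a₀ a₁ c = 0) :
    a₀ = 0 ∨ a₁ = 0 ∨ c = 0 := by
  rcases lt_trichotomy c 0 with hc | hc | hc
  · rw [← theta_swap] at h
    exact Or.inr (Or.inl (eq_zero_of_theta_eq_zero_of_pos (neg_pos.mpr hc) h))
  · exact Or.inr (Or.inr hc)
  · exact Or.inl (eq_zero_of_theta_eq_zero_of_pos hc h)
end

section
/- Let W : ℝ → ℝ satisfy 0 ≤ W(t) for all t and W(−t) = W(t) for all t. Then for all real numbers a₀, a₁, c, one has W(θ(a₀, a₁, c)) ≤ W(a₀) + W(a₁) + W(c). -/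
theorem phi_eq_or (a₀ a₁ c : ℝ) :
    phi a₀ a₁ c = a₀ ∨ phi a₀ a₁ c = a₁ ∨ phi a₀ a₁ c = c ∨ phi a₀ a₁ c = -c := by
  unfold phi
  grind

theorem psi_eq_or (a₀ a₁ c : ℝ) :
    psi a₀ a₁ c = a₀ ∨ psi a₀ a₁ c = a₁ ∨ psi a₀ a₁ c = c ∨ psi a₀ a₁ c = -c := by
  unfold psi
  grind

theorem phi_nonpos_or_psi_nonneg (a₀ a₁ c : ℝ) : phi a₀ a₁ c ≤ 0 ∨ 0 ≤ psi a₀ a₁ c := by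
  simp only [phi, psi, min_le_iff, max_le_iff, le_min_iff, le_max_iff]
  grind

theorem eq_zero_of_phi_nonpos_of_psi_nonneg {a₀ a₁ c : ℝ} (hphi : phi a₀ a₁ c ≤ 0)
    (hpsi : 0 ≤ psi a₀ a₁ c) : a₀ = 0 ∨ a₁ = 0 ∨ c = 0 := by
  simp only [phi, psi, min_le_iff, max_le_iff, le_min_iff, le_max_iff] at hphi hpsi
  grind

/-- `theta a₀ a₁ c` is always one of `a₀`, `a₁`, `c`, up to a sign on `c`. -/
theorem theta_eq_or (a₀ a₁ c : ℝ) :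
    theta a₀ a₁ c = a₀ ∨ theta a₀ a₁ c = a₁ ∨ theta a₀ a₁ c = c ∨ theta a₀ a₁ c = -c := by
  rcases le_total (phi a₀ a₁ c) 0 with hphi | hphi <;>
    rcases le_total 0 (psi a₀ a₁ c) with hpsi | hpsi
  · have htheta : theta a₀ a₁ c = 0 := by simp [theta, hphi, hpsi]
    have := eq_zero_of_phi_nonpos_of_psi_nonneg hphi hpsi
    grind
  · have htheta : theta a₀ a₁ c = psi a₀ a₁ c := by simp [theta, hphi, hpsi]
    rw [htheta]
    exact psi_eq_or a₀ a₁ c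
  · have htheta : theta a₀ a₁ c = phi a₀ a₁ c := by simp [theta, hphi, hpsi]
    rw [htheta]
    exact phi_eq_or a₀ a₁ c
  · rcases phi_nonpos_or_psi_nonneg a₀ a₁ c with h | h
    · have htheta : theta a₀ a₁ c = psi a₀ a₁ c := by simp [theta, h, hpsi]
      rw [htheta]
      exact psi_eq_or a₀ a₁ c
    · have htheta : theta a₀ a₁ c = phi a₀ a₁ c := by simp [theta, hphi, h]
      rw [htheta]
      exact phi_eq_or a₀ a₁ c

theorem potential_of_theta_le (W : ℝ → ℝ) (hW_nonneg : ∀ t, 0 ≤ W t)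
    (hW_even : ∀ t, W (-t) = W t) (a₀ a₁ c : ℝ) :
    W (theta a₀ a₁ c) ≤ W a₀ + W a₁ + W c := by
  have h₀ := hW_nonneg a₀
  have h₁ := hW_nonneg a₁
  have h₂ := hW_nonneg c
  rcases theta_eq_or a₀ a₁ c with h | h | h | h <;> rw [h]
  · linarith
  · linarith
  · linarith
  · rw [hW_even]
    linarith
end

section
/- Let (α, μ) be a measure space, E a normed vector space, and let g_n, g : α → E be strongly measurable with ∫ ‖g(x)‖² dμ < ∞ and ∫ ‖g_n(x) − g(x)‖² dμ → 0 as n → ∞. Let f_n, f : α → ℝ be measurable with f_n → f μ-almost everywhere, and assume g(x) = 0 for μ-almost every x with f(x) = 0. Let κ : ℝ → ℝ be the sign function (κ(t) = 1 for t > 0, κ(0) = 0, κ(t) = −1 for t < 0). Then ∫ ‖κ(f_n(x))·g_n(x) − κ(f(x))·g(x)‖² dμ → 0 as n → ∞. -/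
open MeasureTheory Filter Topology

noncomputable def kappa (t : ℝ) : ℝ := if 0 < t then 1 else if t < 0 then -1 else 0

theorem abs_kappa_le_one (t : ℝ) : |kappa t| ≤ 1 := by
  unfold kappa
  split_ifs <;> simp

theorem measurable_kappa : Measurable kappa :=
  Measurable.ite measurableSet_Ioi measurable_const
    (Measurable.ite measurableSet_Iio measurable_const measurable_const)

theorem kappa_eventuallyEq {t : ℝ} (ht : t ≠ 0) : ∀ᶠ s in 𝓝 t, kappa s = kappa t := by
  rcases ht.lt_or_gt with h | h
  · filter_upwards [Iio_mem_nhds h] with s hs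
    simp [kappa, h, Set.mem_Iio.1 hs, h.le.not_gt, (Set.mem_Iio.1 hs).le.not_gt]
  · filter_upwards [Ioi_mem_nhds h] with s hs
    simp [kappa, h, Set.mem_Ioi.1 hs]

theorem nnnorm_kappa_sub_smul_sq_le {E : Type*} [NormedAddCommGroup E] [NormedSpace ℝ E]
    (s t : ℝ) (w : E) : ‖(kappa s - kappa t) • w‖₊ ^ 2 ≤ 4 * ‖w‖₊ ^ 2 := by
  rw [← NNReal.coe_le_coe]
  push_cast
  have h : |kappa s - kappa t| ≤ 2 := by
    have := abs_sub (kappa s) (kappa t)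
    linarith [abs_kappa_le_one s, abs_kappa_le_one t]
  have h' : ‖(kappa s - kappa t) • w‖ ≤ 2 * ‖w‖ := by
    rw [norm_smul, Real.norm_eq_abs]
    gcongr
  nlinarith [norm_nonneg ((kappa s - kappa t) • w), norm_nonneg w]

theorem nnnorm_kappa_smul_sub_sq_le {E : Type*} [NormedAddCommGroup E] [NormedSpace ℝ E]
    (s t : ℝ) (v w : E) :
    ‖kappa s • v - kappa t • w‖₊ ^ 2 ≤
      2 * ‖v - w‖₊ ^ 2 + 2 * ‖(kappa s - kappa t) • w‖₊ ^ 2 := by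
  rw [← NNReal.coe_le_coe]
  push_cast
  have h : ‖kappa s • v - kappa t • w‖ ≤ ‖v - w‖ + ‖(kappa s - kappa t) • w‖ := by
    calc ‖kappa s • v - kappa t • w‖
        = ‖kappa s • (v - w) + (kappa s - kappa t) • w‖ := by
          congr 1
          module
      _ ≤ ‖kappa s • (v - w)‖ + ‖(kappa s - kappa t) • w‖ := norm_add_le _ _
      _ ≤ ‖v - w‖ + ‖(kappa s - kappa t) • w‖ := by
          gcongr
          rw [norm_smul, Real.norm_eq_abs]
          exact mul_le_of_le_one_left (norm_nonneg _) (abs_kappa_le_one s)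
  nlinarith [norm_nonneg (kappa s • v - kappa t • w),
    sq_nonneg (‖v - w‖ - ‖(kappa s - kappa t) • w‖)]

theorem sign_smul_tendsto_in_L2 {α : Type*} [MeasurableSpace α] (μ : Measure α)
    {E : Type*} [NormedAddCommGroup E] [NormedSpace ℝ E]
    (gn : ℕ → α → E) (g : α → E)
    (hgn : ∀ n, StronglyMeasurable (gn n)) (hg : StronglyMeasurable g)
    (hg_sq : ∫⁻ x, (‖g x‖₊ : ENNReal) ^ 2 ∂μ < ⊤)
    (hgn_conv : Tendsto (fun n => ∫⁻ x, (‖gn n x - g x‖₊ : ENNReal) ^ 2 ∂μ) atTop (𝓝 0))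
    (fn : ℕ → α → ℝ) (f : α → ℝ)
    (hfn : ∀ n, Measurable (fn n)) (hf : Measurable f)
    (hfae : ∀ᵐ x ∂μ, Tendsto (fun n => fn n x) atTop (𝓝 (f x)))
    (hzero : ∀ᵐ x ∂μ, f x = 0 → g x = 0) :
    Tendsto
      (fun n => ∫⁻ x, (‖kappa (fn n x) • gn n x - kappa (f x) • g x‖₊ : ENNReal) ^ 2 ∂μ)
      atTop (𝓝 0) := by
  have hmeas (n : ℕ) :
      Measurable fun x => (‖(kappa (fn n x) - kappa (f x)) • g x‖₊ : ENNReal) ^ 2 := by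
    have h : StronglyMeasurable fun x => (kappa (fn n x) - kappa (f x)) • g x :=
      ((measurable_kappa.comp (hfn n)).sub (measurable_kappa.comp hf)).stronglyMeasurable.smul hg
    exact h.enorm.pow_const 2
  have hdom : Tendsto
      (fun n => ∫⁻ x, (‖(kappa (fn n x) - kappa (f x)) • g x‖₊ : ENNReal) ^ 2 ∂μ)
      atTop (𝓝 0) := by
    rw [← lintegral_zero (μ := μ)]
    refine tendsto_lintegral_of_dominated_convergence
      (fun x => 4 * (‖g x‖₊ : ENNReal) ^ 2) hmeas (fun n => .of_forall fun x => ?_) ?_ ?_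
    · dsimp only
      exact_mod_cast nnnorm_kappa_sub_smul_sq_le (fn n x) (f x) (g x)
    · rw [lintegral_const_mul' _ _ (by norm_num)]
      exact ENNReal.mul_ne_top (by norm_num) hg_sq.ne
    · filter_upwards [hfae, hzero] with x hx hx0
      refine tendsto_const_nhds.congr' ?_
      by_cases h : f x = 0
      · simp [hx0 h]
      · filter_upwards [hx.eventually (kappa_eventuallyEq h)] with n hn
        simp [hn]
  have hbound : Tendsto (fun n => 2 * ∫⁻ x, (‖gn n x - g x‖₊ : ENNReal) ^ 2 ∂μ +
      2 * ∫⁻ x, (‖(kappa (fn n x) - kappa (f x)) • g x‖₊ : ENNReal) ^ 2 ∂μ) atTop (𝓝 0) := by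
    have h := (ENNReal.Tendsto.const_mul (a := 2) hgn_conv (.inr ENNReal.ofNat_ne_top)).add
      (ENNReal.Tendsto.const_mul (a := 2) hdom (.inr ENNReal.ofNat_ne_top))
    simpa using h
  refine tendsto_of_tendsto_of_tendsto_of_le_of_le tendsto_const_nhds hbound
    (fun _ => zero_le) fun n => ?_
  dsimp only
  rw [← lintegral_const_mul' _ _ ENNReal.ofNat_ne_top,
    ← lintegral_const_mul' _ _ ENNReal.ofNat_ne_top,
    ← lintegral_add_right _ ((hmeas n).const_mul 2)]
  refine lintegral_mono fun x => ?_
  simpa only [ENNReal.coe_add, ENNReal.coe_mul, ENNReal.coe_pow, ENNReal.coe_ofNat] using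
    ENNReal.coe_le_coe.2 (nnnorm_kappa_smul_sub_sq_le (fn n x) (f x) (gn n x) (g x))
end

section
/- Let W(t) = (1 − t²)²/4, let μ be a measure on a measurable space α, let h₁, h₂ : α → ℝ be measurable, let δ ∈ (0,1), and let α₀ ∈ (−1+δ, 1−δ). Then μ({h₁ > α₀} ∖ {h₂ > α₀}) ≤ W(1−δ)⁻¹ · ∫⁻ W(h₂(x)) dμ(x) + (α₀ + 1 − δ)⁻² · ∫⁻ (h₁(x) − h₂(x))² dμ(x), where the integrals are Lebesgue (lower) integrals of nonnegative functions. -/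
open MeasureTheory

/-- Markov's inequality for the superlevel sets of a real-valued function. -/
theorem measure_le_inv_ofReal_mul_lintegral {α : Type*} [MeasurableSpace α] (μ : Measure α)
    {f : α → ℝ} (hf : Measurable f) {c : ℝ} (hc : 0 < c) :
    μ {x | c ≤ f x} ≤ (ENNReal.ofReal c)⁻¹ * ∫⁻ x, ENNReal.ofReal (f x) ∂μ := by
  calc μ {x | c ≤ f x} ≤ μ {x | ENNReal.ofReal c ≤ ENNReal.ofReal (f x)} :=
        measure_mono fun _ hx => ENNReal.ofReal_le_ofReal hx
    _ ≤ (∫⁻ x, ENNReal.ofReal (f x) ∂μ) / ENNReal.ofReal c :=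
        meas_ge_le_lintegral_div hf.ennreal_ofReal.aemeasurable
          (ENNReal.ofReal_pos.2 hc).ne' ENNReal.ofReal_ne_top
    _ = _ := by rw [div_eq_mul_inv, mul_comm]

/-- The double-well potential is bounded below on `[-s, s]` by its value at `s ≤ 1`. -/
theorem doubleWell_le_of_abs_le {s t : ℝ} (hs : s ≤ 1) (ht : |t| ≤ s) :
    (1 - s ^ 2) ^ 2 / 4 ≤ (1 - t ^ 2) ^ 2 / 4 := by
  have hs₀ : 0 ≤ s := (abs_nonneg t).trans ht
  have hts : t ^ 2 ≤ s ^ 2 := sq_le_sq.2 (ht.trans (le_abs_self s))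
  have hs₁ : s ^ 2 ≤ 1 := pow_le_one₀ hs₀ hs
  have := pow_le_pow_left₀ (sub_nonneg.2 hs₁) (sub_le_sub_left hts 1) 2
  linarith

theorem superlevel_diff_measure_le {α : Type*} [MeasurableSpace α] (μ : Measure α)
    (h₁ h₂ : α → ℝ) (hh₁ : Measurable h₁) (hh₂ : Measurable h₂)
    (δ : ℝ) (hδ : δ ∈ Set.Ioo (0 : ℝ) 1)
    (a₀ : ℝ) (ha₀ : a₀ ∈ Set.Ioo (-1 + δ) (1 - δ))
    (W : ℝ → ℝ) (hW : ∀ t, W t = (1 - t ^ 2) ^ 2 / 4) :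
    μ ({x | a₀ < h₁ x} \ {x | a₀ < h₂ x}) ≤
      (ENNReal.ofReal (W (1 - δ)))⁻¹ * ∫⁻ x, ENNReal.ofReal (W (h₂ x)) ∂μ +
      (ENNReal.ofReal ((a₀ + 1 - δ) ^ 2))⁻¹ *
        ∫⁻ x, ENNReal.ofReal ((h₁ x - h₂ x) ^ 2) ∂μ := by
  obtain ⟨hδ₀, hδ₁⟩ := hδ
  obtain ⟨ha, ha'⟩ := ha₀
  have hgap : 0 < a₀ + 1 - δ := by linarith
  have hWpos : 0 < W (1 - δ) := by
    have : 0 < 1 - (1 - δ) ^ 2 := by nlinarith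
    rw [hW]
    positivity
  have hWmeas : Measurable fun x => W (h₂ x) := by
    simp only [hW]
    fun_prop
  have hsub : {x | a₀ < h₁ x} \ {x | a₀ < h₂ x} ⊆
      {x | W (1 - δ) ≤ W (h₂ x)} ∪ {x | (a₀ + 1 - δ) ^ 2 ≤ (h₁ x - h₂ x) ^ 2} := by
    rintro x ⟨hx₁, hx₂⟩
    simp only [Set.mem_ofPred_eq, not_lt] at hx₁ hx₂
    rcases le_or_gt (-(1 - δ)) (h₂ x) with h | h
    · left
      simp only [Set.mem_ofPred_eq, hW]
      exact doubleWell_le_of_abs_le (by linarith) (abs_le.2 ⟨h, by linarith⟩)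
    · right
      exact pow_le_pow_left₀ hgap.le (by linarith) 2
  exact (measure_mono hsub).trans <| (measure_union_le _ _).trans <| add_le_add
    (measure_le_inv_ofReal_mul_lintegral μ hWmeas hWpos)
    (measure_le_inv_ofReal_mul_lintegral μ (by fun_prop) (by positivity))
end

section
/- Let M be a type, let Ktop : Set M, and let A, S, B : ℕ → Set M be such that for every s, the sets A(s), S(s), B(s) are pairwise disjoint with A(s) ∪ S(s) ∪ B(s) = univ. Define K : ℕ → Set M recursively by K(0) = K₀ and K(i+1) = (K(i) ∩ (A(i+1) ∪ S(i+1))) ∪ (Ktop ∩ (B(i+1) ∪ S(i+1))). Then for every i, K(i) = (K₀ ∖ ⋃_{1 ≤ s ≤ i} B(s)) ∪ (Ktop ∩ ⋃_{1 ≤ s ≤ i} (B(s) ∪ S(s))). -/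
theorem biUnion_Icc_one_succ {M : Type*} (f : ℕ → Set M) (n : ℕ) :
    ⋃ s ∈ Set.Icc 1 (n + 1), f s = (⋃ s ∈ Set.Icc 1 n, f s) ∪ f (n + 1) := by
  rw [← Set.insert_Icc_right_eq_Icc_add_one (by omega), Set.biUnion_insert, Set.union_comm]

theorem cut_and_paste_closed_form {M : Type*} (K₀ Ktop : Set M) (A S B : ℕ → Set M)
    (hAS : ∀ s, Disjoint (A s) (S s)) (hAB : ∀ s, Disjoint (A s) (B s))
    (hSB : ∀ s, Disjoint (S s) (B s))
    (hcover : ∀ s, A s ∪ S s ∪ B s = Set.univ)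
    (K : ℕ → Set M) (hK0 : K 0 = K₀)
    (hKrec : ∀ i, K (i + 1) =
      (K i ∩ (A (i + 1) ∪ S (i + 1))) ∪ (Ktop ∩ (B (i + 1) ∪ S (i + 1)))) :
    ∀ i, K i = (K₀ \ ⋃ s ∈ Set.Icc 1 i, B s) ∪
      (Ktop ∩ ⋃ s ∈ Set.Icc 1 i, (B s ∪ S s)) := by
  have hcompl (s : ℕ) : A s ∪ S s = (B s)ᶜ :=
    IsCompl.eq_compl ⟨(hAB s).sup_left (hSB s), codisjoint_iff.2 (hcover s)⟩
  intro i
  induction i with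
  | zero => simp [hK0]
  | succ n ih =>
    rw [hKrec, ih, hcompl, biUnion_Icc_one_succ, biUnion_Icc_one_succ]
    ext x
    simp only [Set.mem_union, Set.mem_inter_iff, Set.mem_sdiff, Set.mem_compl_iff]
    tauto
end

section
/- Let M be a type, let Ktop, Ltop : Set M, and let A, S, B : ℕ → Set M be such that for every s, the sets A(s), S(s), B(s) are pairwise disjoint with A(s) ∪ S(s) ∪ B(s) = univ. Define K : ℕ → Set M by K(0) = K₀ and K(i+1) = (K(i) ∩ (A(i+1) ∪ S(i+1))) ∪ (Ktop ∩ (B(i+1) ∪ S(i+1))), and define L : ℕ → Set M analogously from L₀ and Ltop. Then for every i, K(i) ∩ L(i) ⊆ (K₀ ∩ L₀ ∖ ⋃_{1 ≤ s ≤ i} B(s)) ∪ (Ktop ∩ Ltop ∩ ⋃_{1 ≤ s ≤ i} (B(s) ∪ S(s))) ∪ ⋃_{1 ≤ s ≤ i} S(s). -/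
theorem cut_and_paste_interface_subset {M : Type*} (K₀ L₀ Ktop Ltop : Set M)
    (A S B : ℕ → Set M)
    (hAS : ∀ s, Disjoint (A s) (S s)) (hAB : ∀ s, Disjoint (A s) (B s))
    (hSB : ∀ s, Disjoint (S s) (B s))
    (hcover : ∀ s, A s ∪ S s ∪ B s = Set.univ)
    (K : ℕ → Set M) (hK0 : K 0 = K₀)
    (hKrec : ∀ i, K (i + 1) =
      (K i ∩ (A (i + 1) ∪ S (i + 1))) ∪ (Ktop ∩ (B (i + 1) ∪ S (i + 1))))
    (L : ℕ → Set M) (hL0 : L 0 = L₀)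
    (hLrec : ∀ i, L (i + 1) =
      (L i ∩ (A (i + 1) ∪ S (i + 1))) ∪ (Ltop ∩ (B (i + 1) ∪ S (i + 1)))) :
    ∀ i, K i ∩ L i ⊆
      ((K₀ ∩ L₀) \ ⋃ s ∈ Set.Icc 1 i, B s) ∪
        (Ktop ∩ Ltop ∩ ⋃ s ∈ Set.Icc 1 i, (B s ∪ S s)) ∪
        ⋃ s ∈ Set.Icc 1 i, S s := by
  intro i
  induction i with
  | zero => simp [hK0, hL0]
  | succ i ih =>
    rintro x ⟨hxK, hxL⟩
    have mem_last : i + 1 ∈ Set.Icc 1 (i + 1) := ⟨by omega, le_rfl⟩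
    have mem_succ : ∀ {s}, s ∈ Set.Icc 1 i → s ∈ Set.Icc 1 (i + 1) :=
      fun hs => ⟨hs.1, hs.2.trans i.le_succ⟩
    rw [hKrec] at hxK
    rw [hLrec] at hxL
    by_cases hxS : x ∈ S (i + 1)
    · exact Or.inr (Set.mem_biUnion mem_last hxS)
    by_cases hxB : x ∈ B (i + 1)
    · have hxA : x ∉ A (i + 1) := fun h => Set.disjoint_left.1 (hAB _) h hxB
      have hxKtop : x ∈ Ktop := hxK.elim (fun h => (h.2.elim hxA hxS).elim) And.left
      have hxLtop : x ∈ Ltop := hxL.elim (fun h => (h.2.elim hxA hxS).elim) And.left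
      exact Or.inl (Or.inr ⟨⟨hxKtop, hxLtop⟩, Set.mem_biUnion mem_last (Or.inl hxB)⟩)
    · have hxKi : x ∈ K i := hxK.elim And.left fun h => (h.2.elim hxB hxS).elim
      have hxLi : x ∈ L i := hxL.elim And.left fun h => (h.2.elim hxB hxS).elim
      rcases ih ⟨hxKi, hxLi⟩ with (⟨hx₀, hx⟩ | ⟨hxtop, hx⟩) | hx
      · refine Or.inl (Or.inl ⟨hx₀, fun h => ?_⟩)
        obtain ⟨s, hs, hxs⟩ := Set.mem_iUnion₂.1 h
        rcases hs.2.lt_or_eq with hlt | rfl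
        · exact hx (Set.mem_biUnion (show s ∈ Set.Icc 1 i from ⟨hs.1, Nat.le_of_lt_succ hlt⟩) hxs)
        · exact hxB hxs
      · exact Or.inl (Or.inr ⟨hxtop, Set.biUnion_subset_biUnion_left (fun _ => mem_succ) hx⟩)
      · exact Or.inr (Set.biUnion_subset_biUnion_left (fun _ => mem_succ) hx)
end
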